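/- arXiv:math/0311283 — 3 statements merged into one kernel-verified Lean document; each statement's English description precedes it below -/
import Mathlib

section
/- Let f1, f2, f3 be integers with f1 ≥ f2 and f2 − f3 ≥ 2, and let N be a real-valued function of pairs (k, ℓ) of nonnegative integers with 0 ≤ k ≤ f1 − f2 satisfying: N(0,0) = 1; N(0,ℓ) = [ℓ]·[f1−f3+ℓ−1]·N(0,ℓ−1) for all ℓ ≥ 1; and N(k,ℓ) = ([k]·[f1−f2−k+1]·[f2−f3+k−2]/[f1−f2−k+ℓ+2])·N(k−1,ℓ) for all 1 ≤ k ≤ f1−f2 and ℓ ≥ 0. Then for all 0 ≤ k ≤ f1−f2 and ℓ ≥ 0, N(k,ℓ) = ([k]!·[ℓ]!·[f1−f2]!·[f1−f2−k+ℓ+1]!·[f2−f3+k−2]!·[f1−f3+ℓ−1]!)/([f1−f2−k]!·[f1−f2+ℓ+1]!·[f1−f3−1]!·[f2−f3−2]!). -/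
noncomputable def qnum (q : ℝ) (n : ℤ) : ℝ := (q ^ n - q ^ (-n)) / (q - q⁻¹)

noncomputable def qfact (q : ℝ) : ℕ → ℝ
  | 0 => 1
  | n + 1 => qnum q ((n : ℤ) + 1) * qfact q n

/-- q-factorial of an integer argument (the arguments occurring below are nonnegative). -/
noncomputable def qfactZ (q : ℝ) (n : ℤ) : ℝ := qfact q n.toNat

theorem qnum_ne_zero {q : ℝ} (hq : 0 < q) (hq1 : q ≠ 1) {n : ℤ} (hn : n ≠ 0) :
    qnum q n ≠ 0 := by
  have key : ∀ m : ℤ, m ≠ 0 → q ^ m - q ^ (-m) ≠ 0 := fun m hm h => by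
    have := zpow_right_injective₀ hq hq1 (sub_eq_zero.mp h)
    omega
  have h1 := key 1 one_ne_zero
  rw [zpow_neg, zpow_one] at h1
  exact div_ne_zero (key n hn) h1

theorem qfactZ_ne_zero {q : ℝ} (hq : 0 < q) (hq1 : q ≠ 1) (n : ℤ) : qfactZ q n ≠ 0 := by
  unfold qfactZ
  induction n.toNat with
  | zero => exact one_ne_zero
  | succ m ih => exact mul_ne_zero (qnum_ne_zero hq hq1 (by omega)) ih

theorem qfactZ_zero (q : ℝ) : qfactZ q 0 = 1 := rfl

theorem qfactZ_add_one (q : ℝ) {n : ℤ} (hn : 0 ≤ n) :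
    qfactZ q (n + 1) = qnum q (n + 1) * qfactZ q n := by
  lift n to ℕ using hn
  rfl

/-- The squared norms `N(k,ℓ) = N²(k,ℓ)` of the U-spin basis vectors of a
positive-discrete-series irreducible representation of `u_q(2,1)` with lowest weight
`(f1,f2,f3)` satisfy the recursions (A.21), (A.22) with `N(0,0)=1`; hence they are given
by the closed formula (A.23). -/
theorem uSpin_norm_closed_form (q : ℝ) (hq : 0 < q) (hq1 : q ≠ 1)
    (f1 f2 f3 : ℤ) (h12 : f2 ≤ f1) (h23 : 2 ≤ f2 - f3)
    (N : ℕ → ℕ → ℝ)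
    (h00 : N 0 0 = 1)
    (h0l : ∀ l : ℕ, 1 ≤ l →
      N 0 l = qnum q (l : ℤ) * qnum q (f1 - f3 + (l : ℤ) - 1) * N 0 (l - 1))
    (hkl : ∀ k l : ℕ, 1 ≤ k → (k : ℤ) ≤ f1 - f2 →
      N k l = qnum q (k : ℤ) * qnum q (f1 - f2 - (k : ℤ) + 1) *
          qnum q (f2 - f3 + (k : ℤ) - 2) / qnum q (f1 - f2 - (k : ℤ) + (l : ℤ) + 2) *
          N (k - 1) l) :
    ∀ k l : ℕ, (k : ℤ) ≤ f1 - f2 →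
      N k l =
        qfactZ q (k : ℤ) * qfactZ q (l : ℤ) * qfactZ q (f1 - f2) *
            qfactZ q (f1 - f2 - (k : ℤ) + (l : ℤ) + 1) *
            qfactZ q (f2 - f3 + (k : ℤ) - 2) * qfactZ q (f1 - f3 + (l : ℤ) - 1) /
          (qfactZ q (f1 - f2 - (k : ℤ)) * qfactZ q (f1 - f2 + (l : ℤ) + 1) *
            qfactZ q (f1 - f3 - 1) * qfactZ q (f2 - f3 - 2)) := by
  have hne := qfactZ_ne_zero hq hq1
  intro k l hk
  induction k with
  | zero =>
    have hl : N 0 l = qfactZ q l * qfactZ q (f1 - f3 + l - 1) / qfactZ q (f1 - f3 - 1) := by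
      induction l with
      | zero => simp [h00, qfactZ_zero, hne]
      | succ l ih =>
        have e : f1 - f3 + ((l + 1 : ℕ) : ℤ) - 1 = f1 - f3 + l - 1 + 1 := by push_cast; ring
        rw [h0l (l + 1) (by omega), Nat.add_sub_cancel, ih, e, Nat.cast_succ,
          qfactZ_add_one q (n := l) (by omega),
          qfactZ_add_one q (n := f1 - f3 + l - 1) (by omega)]
        ring
    rw [hl]
    simp only [Nat.cast_zero, sub_zero, add_zero, qfactZ_zero]
    have h1 := hne (f1 - f2)
    have h2 := hne (f1 - f2 + l + 1)
    have h3 := hne (f1 - f3 - 1)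
    have h4 := hne (f2 - f3 - 2)
    field_simp
  | succ k ih =>
    push_cast at hk
    rw [hkl (k + 1) l (by omega) (by push_cast; exact hk), Nat.add_sub_cancel, ih (by omega)]
    have e1 : f1 - f2 - ((k + 1 : ℕ) : ℤ) + 1 = f1 - f2 - (k + 1) + 1 := by push_cast; ring
    have e2 : f2 - f3 + ((k + 1 : ℕ) : ℤ) - 2 = f2 - f3 + k - 2 + 1 := by push_cast; ring
    have e3 : f1 - f2 - ((k + 1 : ℕ) : ℤ) + l + 2 = f1 - f2 - k + l + 1 := by push_cast; ring
    have e4 : f1 - f2 - ((k + 1 : ℕ) : ℤ) + l + 1 = f1 - f2 - k + l := by push_cast; ring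
    have e5 : f1 - f2 - (k : ℤ) = f1 - f2 - (k + 1) + 1 := by ring
    rw [e1, e2, e3, e4, qfactZ_add_one q (n := f1 - f2 - k + l) (by omega),
      qfactZ_add_one q (n := f2 - f3 + k - 2) (by omega), Nat.cast_succ,
      qfactZ_add_one q (n := k) (by omega),
      show qfactZ q (f1 - f2 - k) = _ from
        (congrArg _ e5).trans (qfactZ_add_one q (n := f1 - f2 - (k + 1)) (by omega))]
    have n1 : qnum q (f1 - f2 - k + l + 1) ≠ 0 := qnum_ne_zero hq hq1 (by omega)
    have n2 : qnum q (f1 - f2 - (k + 1) + 1) ≠ 0 := qnum_ne_zero hq hq1 (by omega)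
    have h1 := hne (f1 - f2 - (k + 1))
    have h2 := hne (f1 - f2 + l + 1)
    have h3 := hne (f1 - f3 - 1)
    have h4 := hne (f2 - f3 - 2)
    field_simp
end

section
/- Let f1, f2, f3 be integers and k, ℓ, s, p nonnegative integers with f2−f3 ≥ 2, k ≤ f1−f2, p ≤ f1−f2, p+ℓ ≥ s, ℓ+k ≥ s, and f1−f2−k−p+s ≥ 0. Set 2T = f2−f3+p+s−2, 2j3 = ℓ+k, 2j2 = f2−f3+p−s+ℓ+k−2, 2U = f1−f2−k+ℓ, 2j1 = f1−f3−p+s−2, 2j = f1−f2, U−M_U = p−s+ℓ, U+M_U = f1−f2−k−p+s, and T+M = f2−f3+p+ℓ+k−1. Then, with a = T, b = j3, c = j2, d = U, e = j1, f = j, the prefactor identity holds: ([2U+1][2T+1][k]![ℓ+k−s]![U+M_U]![T+M]![f1−f2−k]![f1−f2+ℓ+1]![f2−f3+s−2]![f2−f3+p−2]!)/([s]![p]![ℓ]![U−M_U]![f1−f3+s−1]![f1−f2−p]![f2−f3+k−2]![f1−f3+ℓ−1]!) = ([2U+1][2T+1]/([2j2+1][2j+1])) · ([2c+1][2f+1][a+b+c+1]![b+d+f+1]![a−b+c]![−a+b+c]![a+e−f]![b−d+f]![−b+d+f]![−c+d+e]!)/([a+e+f+1]![c+d+e+1]![a+b−c]![a−e+f]![b+d−f]![c+d−e]![c−d+e]![−a+e+f]!).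 -/
/-- q-number of a rational argument (used only at integer-valued rationals). -/
noncomputable def qnumQ (q : ℝ) (x : ℚ) : ℝ := qnum q ⌊x⌋

/-- q-factorial of a rational argument (used only at nonnegative integer-valued
rationals). -/
noncomputable def qfactQ (q : ℝ) (x : ℚ) : ℝ := qfact q (⌊x⌋).toNat

/-- The explicit q-Racah coefficient `U_q(a b e d; c f)` of `su_q(2)` (formula (5.31) of
Asherova–Smirnov–Tolstoy), the sum running over all integers `n ≥ 0` for which every
q-factorial argument is nonnegative. -/
noncomputable def URacah (q : ℝ) (a b e d c f : ℚ) : ℝ :=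
  (-1 : ℝ) ^ ⌊a + d - c - f⌋ *
    Real.sqrt (qnumQ q (2 * c + 1) * qnumQ q (2 * f + 1) * qfactQ q (a + b + c + 1) *
      qfactQ q (b + d + f + 1) * qfactQ q (a - b + c) * qfactQ q (-a + b + c) *
      qfactQ q (a + e - f) * qfactQ q (b - d + f) * qfactQ q (-b + d + f) *
      qfactQ q (-c + d + e) /
      (qfactQ q (a + e + f + 1) * qfactQ q (c + d + e + 1) * qfactQ q (a + b - c) *
        qfactQ q (a - e + f) * qfactQ q (b + d - f) * qfactQ q (c + d - e) *
        qfactQ q (c - d + e) * qfactQ q (-a + e + f))) *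
    ∑ n ∈ Finset.range ((⌊2 * b⌋).toNat + 1),
      if 0 ≤ 2 * b - n ∧ 0 ≤ b + c - e + f - n ∧ 0 ≤ b + c + e + f + 1 - n ∧
          0 ≤ -a + b + c - n ∧ 0 ≤ b - d + f - n ∧ 0 ≤ a + b + c + 1 - n ∧
          0 ≤ b + d + f + 1 - n then
        (-1 : ℝ) ^ n * qfactQ q (2 * b - n) * qfactQ q (b + c - e + f - n) *
          qfactQ q (b + c + e + f + 1 - n) /
          (qfact q n * qfactQ q (-a + b + c - n) * qfactQ q (b - d + f - n) *
            qfactQ q (a + b + c + 1 - n) * qfactQ q (b + d + f + 1 - n))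
      else 0

/-- The q-Weyl coefficient `⟨U|T⟩_q` (formula (113)) for the positive discrete series of
`u_q(2,1)` with lowest weight `(f1,f2,f3)`, expressed through the labels `k, ℓ, s, p` via
`2U = f1−f2−k+ℓ`, `2T = f2−f3+p+s−2`, `U−M_U = p−s+ℓ`, `U+M_U = f1−f2−k−p+s`,
`T+M = f2−f3+p+ℓ+k−1`. -/
noncomputable def qWeyl (q : ℝ) (f1 f2 f3 : ℤ) (k l s p : ℕ) : ℝ :=
  Real.sqrt (qnum q (f1 - f2 - (k : ℤ) + (l : ℤ) + 1) *
      qnum q (f2 - f3 + (p : ℤ) + (s : ℤ) - 1) * qfact q k *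
      qfactZ q ((l : ℤ) + (k : ℤ) - (s : ℤ)) *
      qfactZ q (f1 - f2 - (k : ℤ) - (p : ℤ) + (s : ℤ)) *
      qfactZ q (f2 - f3 + (p : ℤ) + (l : ℤ) + (k : ℤ) - 1) *
      qfactZ q (f1 - f2 - (k : ℤ)) * qfactZ q (f1 - f2 + (l : ℤ) + 1) *
      qfactZ q (f2 - f3 + (s : ℤ) - 2) * qfactZ q (f2 - f3 + (p : ℤ) - 2) /
      (qfact q s * qfact q p * qfact q l * qfactZ q ((p : ℤ) - (s : ℤ) + (l : ℤ)) *
        qfactZ q (f1 - f3 + (s : ℤ) - 1) * qfactZ q (f1 - f2 - (p : ℤ)) *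
        qfactZ q (f2 - f3 + (k : ℤ) - 2) * qfactZ q (f1 - f3 + (l : ℤ) - 1))) *
    ∑ n ∈ Finset.range (min k (l + k - s) + 1),
      (-1 : ℝ) ^ (k + n) *
        qfactZ q ((p : ℤ) - (s : ℤ) + (l : ℤ) + (k : ℤ) - (n : ℤ)) *
        qfactZ q ((l : ℤ) + (k : ℤ) - (n : ℤ)) *
        qfactZ q (f1 - f3 + (l : ℤ) + (k : ℤ) - (n : ℤ) - 1) /
        (qfact q n * qfact q (k - n) * qfactZ q (f1 - f2 + (l : ℤ) + 1 - (n : ℤ)) *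
          qfactZ q ((l : ℤ) + (k : ℤ) - (s : ℤ) - (n : ℤ)) *
          qfactZ q (f2 - f3 + (p : ℤ) + (l : ℤ) + (k : ℤ) - (n : ℤ) - 1))

theorem qnumQ_eq_qnum (q : ℝ) {x : ℚ} {n : ℤ} (h : x = n) : qnumQ q x = qnum q n := by
  rw [qnumQ, h, Int.floor_intCast]

theorem qfactQ_eq_qfactZ (q : ℝ) {x : ℚ} {n : ℤ} (h : x = n) : qfactQ q x = qfactZ q n := by
  rw [qfactQ, h, Int.floor_intCast, qfactZ]

theorem qfactQ_eq_qfact (q : ℝ) {x : ℚ} {n : ℕ} (h : x = n) : qfactQ q x = qfact q n := by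
  rw [qfactQ, h, Int.floor_natCast, Int.toNat_natCast]

/-- The prefactor identity between the quantity under the square root in the q-Weyl
coefficient ⟨U|T⟩_q for the positive discrete series of u_q(2,1) and the quantity under
the square root in the explicit q-Racah coefficient U_q(a b e d; c f) of su_q(2), under
the substitution a = T, b = j3, c = j2, d = U, e = j1, f = j. -/
theorem weyl_racah_prefactor_identity
    (q : ℝ) (hq : 0 < q) (hq1 : q ≠ 1)
    (f1 f2 f3 : ℤ) (k l s p : ℕ)
    (h23 : 2 ≤ f2 - f3) (hk : (k : ℤ) ≤ f1 - f2) (hp : (p : ℤ) ≤ f1 - f2)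
    (hpls : (s : ℤ) ≤ (p : ℤ) + (l : ℤ)) (hlks : (s : ℤ) ≤ (l : ℤ) + (k : ℤ))
    (hkps : 0 ≤ f1 - f2 - (k : ℤ) - (p : ℤ) + (s : ℤ))
    (T j1 j2 j3 U j : ℚ)
    (hT : 2 * T = (f2 : ℚ) - (f3 : ℚ) + (p : ℚ) + (s : ℚ) - 2)
    (hj1 : 2 * j1 = (f1 : ℚ) - (f3 : ℚ) - (p : ℚ) + (s : ℚ) - 2)
    (hj2 : 2 * j2 = (f2 : ℚ) - (f3 : ℚ) + (p : ℚ) - (s : ℚ) + (l : ℚ) + (k : ℚ) - 2)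
    (hj3 : 2 * j3 = (l : ℚ) + (k : ℚ))
    (hU : 2 * U = (f1 : ℚ) - (f2 : ℚ) - (k : ℚ) + (l : ℚ))
    (hj : 2 * j = (f1 : ℚ) - (f2 : ℚ))
    (MU M : ℚ)
    (hMU : U - MU = (p : ℚ) - (s : ℚ) + (l : ℚ))
    (hMU' : U + MU = (f1 : ℚ) - (f2 : ℚ) - (k : ℚ) - (p : ℚ) + (s : ℚ))
    (hTM : T + M = (f2 : ℚ) - (f3 : ℚ) + (p : ℚ) + (l : ℚ) + (k : ℚ) - 1) :
    qnumQ q (2 * U + 1) * qnumQ q (2 * T + 1) * qfact q k *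
        qfactZ q ((l : ℤ) + (k : ℤ) - (s : ℤ)) * qfactQ q (U + MU) * qfactQ q (T + M) *
        qfactZ q (f1 - f2 - (k : ℤ)) * qfactZ q (f1 - f2 + (l : ℤ) + 1) *
        qfactZ q (f2 - f3 + (s : ℤ) - 2) * qfactZ q (f2 - f3 + (p : ℤ) - 2) /
        (qfact q s * qfact q p * qfact q l * qfactQ q (U - MU) *
          qfactZ q (f1 - f3 + (s : ℤ) - 1) * qfactZ q (f1 - f2 - (p : ℤ)) *
          qfactZ q (f2 - f3 + (k : ℤ) - 2) * qfactZ q (f1 - f3 + (l : ℤ) - 1)) =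
      qnumQ q (2 * U + 1) * qnumQ q (2 * T + 1) /
          (qnumQ q (2 * j2 + 1) * qnumQ q (2 * j + 1)) *
        (qnumQ q (2 * j2 + 1) * qnumQ q (2 * j + 1) * qfactQ q (T + j3 + j2 + 1) *
          qfactQ q (j3 + U + j + 1) * qfactQ q (T - j3 + j2) * qfactQ q (-T + j3 + j2) *
          qfactQ q (T + j1 - j) * qfactQ q (j3 - U + j) * qfactQ q (-j3 + U + j) *
          qfactQ q (-j2 + U + j1) /
          (qfactQ q (T + j1 + j + 1) * qfactQ q (j2 + U + j1 + 1) *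
            qfactQ q (T + j3 - j2) * qfactQ q (T - j1 + j) * qfactQ q (j3 + U - j) *
            qfactQ q (j2 + U - j1) * qfactQ q (j2 - U + j1) * qfactQ q (-T + j1 + j))) := by
  have hc : qnumQ q (2 * j2 + 1) ≠ 0 := by
    rw [qnumQ_eq_qnum q (show 2 * j2 + 1 =
      (f2 - f3 + (p : ℤ) - (s : ℤ) + (l : ℤ) + (k : ℤ) - 1 : ℤ) by push_cast; linarith)]
    exact qnum_ne_zero hq hq1 (by omega)
  have hf : qnumQ q (2 * j + 1) ≠ 0 := by
    rw [qnumQ_eq_qnum q (show 2 * j + 1 = (f1 - f2 + 1 : ℤ) by push_cast; linarith)]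
    exact qnum_ne_zero hq hq1 (by omega)
  rw [show T + j3 + j2 + 1 = T + M by linarith,
    qfactQ_eq_qfactZ q (show j3 + U + j + 1 = (f1 - f2 + (l : ℤ) + 1 : ℤ) by push_cast; linarith),
    qfactQ_eq_qfactZ q (show T - j3 + j2 = (f2 - f3 + (p : ℤ) - 2 : ℤ) by push_cast; linarith),
    qfactQ_eq_qfactZ q (show -T + j3 + j2 = ((l : ℤ) + (k : ℤ) - (s : ℤ) : ℤ) by push_cast; linarith),
    qfactQ_eq_qfactZ q (show T + j1 - j = (f2 - f3 + (s : ℤ) - 2 : ℤ) by push_cast; linarith),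
    qfactQ_eq_qfact q (show j3 - U + j = (k : ℕ) by linarith),
    qfactQ_eq_qfactZ q (show -j3 + U + j = (f1 - f2 - (k : ℤ) : ℤ) by push_cast; linarith),
    show -j2 + U + j1 = U + MU by linarith,
    qfactQ_eq_qfactZ q (show T + j1 + j + 1 = (f1 - f3 + (s : ℤ) - 1 : ℤ) by push_cast; linarith),
    qfactQ_eq_qfactZ q (show j2 + U + j1 + 1 = (f1 - f3 + (l : ℤ) - 1 : ℤ) by push_cast; linarith),
    qfactQ_eq_qfact q (show T + j3 - j2 = (s : ℕ) by linarith),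
    qfactQ_eq_qfact q (show T - j1 + j = (p : ℕ) by linarith),
    qfactQ_eq_qfact q (show j3 + U - j = (l : ℕ) by linarith),
    show j2 + U - j1 = U - MU by linarith,
    qfactQ_eq_qfactZ q (show j2 - U + j1 = (f2 - f3 + (k : ℤ) - 2 : ℤ) by push_cast; linarith),
    qfactQ_eq_qfactZ q (show -T + j1 + j = (f1 - f2 - (p : ℤ) : ℤ) by push_cast; linarith),
    div_mul_div_comm, mul_comm (qnumQ q (2 * U + 1) * qnumQ q (2 * T + 1))]
  rw [← mul_div_mul_left _ _ (mul_ne_zero hc hf)]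
  congr 1 <;> ring
end

section
/- Let f1, f2, f3 be integers and k, ℓ, s, p nonnegative integers with f2−f3 ≥ 2, k ≤ f1−f2, p ≤ f1−f2, p+ℓ ≥ s, ℓ+k ≥ s, and f1−f2−k−p+s ≥ 0. Define 2U = f1−f2−k+ℓ, 2T = f2−f3+p+s−2, U−M_U = p−s+ℓ, U+M_U = f1−f2−k−p+s, T+M = f2−f3+p+ℓ+k−1, 2j1 = f1−f3−p+s−2, 2j2 = f2−f3+p−s+ℓ+k−2, 2j3 = ℓ+k, 2j = f1−f2. Then the q-Weyl coefficient satisfies ⟨U|T⟩_q = (−1)^s · sqrt( [2U+1][2T+1] / ([2j2+1][2j+1]) ) · U_q(T j3 j1 U; j2 j), where U_q is the explicit q-Racah coefficient of su_q(2). -/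
theorem qnum_pos {q : ℝ} (hq : 0 < q) (hq1 : q ≠ 1) {n : ℤ} (hn : 0 < n) : 0 < qnum q n := by
  unfold qnum
  rcases lt_or_gt_of_ne hq1 with h | h
  · apply div_pos_of_neg_of_neg
    · exact sub_neg.mpr (zpow_lt_zpow_right_of_lt_one₀ hq h (by omega))
    · exact sub_neg.mpr (h.trans ((one_lt_inv₀ hq).mpr h))
  · apply div_pos
    · exact sub_pos.mpr (zpow_lt_zpow_right₀ h (by omega))
    · exact sub_pos.mpr ((inv_lt_one_of_one_lt₀ h).trans h)

theorem qnumQ_intCast (q : ℝ) (z : ℤ) : qnumQ q (z : ℚ) = qnum q z := by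
  rw [qnumQ, Int.floor_intCast]

theorem qfactQ_intCast (q : ℝ) (z : ℤ) : qfactQ q (z : ℚ) = qfactZ q z := by
  rw [qfactQ, qfactZ, Int.floor_intCast]

theorem qfactQ_intCast_sub_natCast (q : ℝ) (z : ℤ) (n : ℕ) :
    qfactQ q ((z : ℚ) - (n : ℚ)) = qfactZ q (z - n) := by
  rw [← qfactQ_intCast]
  push_cast
  rfl

theorem intCast_sub_natCast_nonneg (z : ℤ) (n : ℕ) :
    0 ≤ (z : ℚ) - (n : ℚ) ↔ 0 ≤ z - n := by
  exact_mod_cast Iff.rfl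

theorem qfactZ_natCast (q : ℝ) (n : ℕ) : qfactZ q (n : ℤ) = qfact q n := by
  rw [qfactZ, Int.toNat_natCast]

set_option maxHeartbeats 1000000 in
/-- The q-Weyl coefficient ⟨U|T⟩_q for the positive discrete series of u_q(2,1) equals
(−1)^s · sqrt([2U+1][2T+1]/([2j2+1][2j+1])) · U_q(T j3 j1 U; j2 j), where U_q is the
explicit q-Racah coefficient of su_q(2) (first equality in (117)). -/
theorem qWeyl_eq_racah_first
    (q : ℝ) (hq : 0 < q) (hq1 : q ≠ 1)
    (f1 f2 f3 : ℤ) (k l s p : ℕ)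
    (h23 : 2 ≤ f2 - f3) (hk : (k : ℤ) ≤ f1 - f2) (hp : (p : ℤ) ≤ f1 - f2)
    (hpls : (s : ℤ) ≤ (p : ℤ) + (l : ℤ)) (hlks : (s : ℤ) ≤ (l : ℤ) + (k : ℤ))
    (hkps : 0 ≤ f1 - f2 - (k : ℤ) - (p : ℤ) + (s : ℤ))
    (T j1 j2 j3 U j : ℚ)
    (hT : 2 * T = (f2 : ℚ) - (f3 : ℚ) + (p : ℚ) + (s : ℚ) - 2)
    (hj1 : 2 * j1 = (f1 : ℚ) - (f3 : ℚ) - (p : ℚ) + (s : ℚ) - 2)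
    (hj2 : 2 * j2 = (f2 : ℚ) - (f3 : ℚ) + (p : ℚ) - (s : ℚ) + (l : ℚ) + (k : ℚ) - 2)
    (hj3 : 2 * j3 = (l : ℚ) + (k : ℚ))
    (hU : 2 * U = (f1 : ℚ) - (f2 : ℚ) - (k : ℚ) + (l : ℚ))
    (hj : 2 * j = (f1 : ℚ) - (f2 : ℚ)) :
    qWeyl q f1 f2 f3 k l s p =
      (-1 : ℝ) ^ s *
        Real.sqrt (qnumQ q (2 * U + 1) * qnumQ q (2 * T + 1) /
          (qnumQ q (2 * j2 + 1) * qnumQ q (2 * j + 1))) *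
        URacah q T j3 j1 U j2 j := by
  have e0 : 2 * U + 1 = ((f1 - f2 - k + l + 1 : ℤ) : ℚ) := by push_cast; linarith
  have e1 : 2 * T + 1 = ((f2 - f3 + p + s - 1 : ℤ) : ℚ) := by push_cast; linarith
  have e2 : 2 * j2 + 1 = ((f2 - f3 + p - s + l + k - 1 : ℤ) : ℚ) := by push_cast; linarith
  have e3 : 2 * j + 1 = ((f1 - f2 + 1 : ℤ) : ℚ) := by push_cast; linarith
  have e4 : T + U - j2 - j = ((s - k : ℤ) : ℚ) := by push_cast; linarith
  have e5 : T + j3 + j2 + 1 = ((f2 - f3 + p + l + k - 1 : ℤ) : ℚ) := by push_cast; linarith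
  have e6 : j3 + U + j + 1 = ((f1 - f2 + l + 1 : ℤ) : ℚ) := by push_cast; linarith
  have e7 : T - j3 + j2 = ((f2 - f3 + p - 2 : ℤ) : ℚ) := by push_cast; linarith
  have e8 : -T + j3 + j2 = ((l + k - s : ℤ) : ℚ) := by push_cast; linarith
  have e9 : T + j1 - j = ((f2 - f3 + s - 2 : ℤ) : ℚ) := by push_cast; linarith
  have e10 : j3 - U + j = ((k : ℤ) : ℚ) := by push_cast; linarith
  have e11 : -j3 + U + j = ((f1 - f2 - k : ℤ) : ℚ) := by push_cast; linarith
  have e12 : -j2 + U + j1 = ((f1 - f2 - k - p + s : ℤ) : ℚ) := by push_cast; linarith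
  have e13 : T + j1 + j + 1 = ((f1 - f3 + s - 1 : ℤ) : ℚ) := by push_cast; linarith
  have e14 : j2 + U + j1 + 1 = ((f1 - f3 + l - 1 : ℤ) : ℚ) := by push_cast; linarith
  have e15 : T + j3 - j2 = ((s : ℤ) : ℚ) := by push_cast; linarith
  have e16 : T - j1 + j = ((p : ℤ) : ℚ) := by push_cast; linarith
  have e17 : j3 + U - j = ((l : ℤ) : ℚ) := by push_cast; linarith
  have e18 : j2 + U - j1 = ((p - s + l : ℤ) : ℚ) := by push_cast; linarith
  have e19 : j2 - U + j1 = ((f2 - f3 + k - 2 : ℤ) : ℚ) := by push_cast; linarith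
  have e20 : -T + j1 + j = ((f1 - f2 - p : ℤ) : ℚ) := by push_cast; linarith
  have e21 : 2 * j3 = ((l + k : ℤ) : ℚ) := by push_cast; linarith
  have e22 : j3 + j2 - j1 + j = ((p - s + l + k : ℤ) : ℚ) := by push_cast; linarith
  have e23 : j3 + j2 + j1 + j + 1 = ((f1 - f3 + l + k - 1 : ℤ) : ℚ) := by push_cast; linarith
  unfold qWeyl URacah
  simp only [e0, e1, e2, e3, e4, e5, e6, e7, e8, e9, e10, e11, e12, e13, e14, e15, e16, e17, e18, e19, e20, e21, e22, e23, qnumQ_intCast, qfactQ_intCast,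
    qfactQ_intCast_sub_natCast, intCast_sub_natCast_nonneg, Int.floor_intCast, qfactZ_natCast]
  have hU1 : 0 < qnum q (f1 - f2 - k + l + 1) := qnum_pos hq hq1 (by omega)
  have hT1 : 0 < qnum q (f2 - f3 + p + s - 1) := qnum_pos hq hq1 (by omega)
  have hj21 : 0 < qnum q (f2 - f3 + p - s + l + k - 1) := qnum_pos hq hq1 (by omega)
  have hj01 : 0 < qnum q (f1 - f2 + 1) := qnum_pos hq hq1 (by omega)
  have hsign : (-1 : ℝ) ^ s * (-1 : ℝ) ^ ((s : ℤ) - (k : ℤ)) = (-1 : ℝ) ^ k := by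
    rw [zpow_sub₀ (by norm_num), zpow_natCast, zpow_natCast, mul_div_assoc', ← mul_pow]
    norm_num
    rcases neg_one_pow_eq_or ℝ k with h | h <;> rw [h] <;> norm_num
  rw [mul_assoc (_ ^ ((s : ℤ) - k)), mul_mul_mul_comm, hsign, mul_assoc,
    ← mul_assoc (Real.sqrt _) (Real.sqrt _), ← Real.sqrt_mul (by positivity),
    mul_left_comm ((-1 : ℝ) ^ k)]
  congr 1
  · congr 1
    refine (mul_div_mul_left _ _ (mul_pos hj21 hj01).ne').symm.trans ?_
    rw [div_mul_div_comm]
    congr 1 <;> ring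
  · symm
    rw [Finset.mul_sum,
      ← Finset.sum_subset (s₁ := Finset.range (min k (l + k - s) + 1))]
    · refine Finset.sum_congr rfl fun n hn => ?_
      rw [Finset.mem_range] at hn
      rw [if_pos (by omega), show (k : ℤ) - n = ((k - n : ℕ) : ℤ) by omega, qfactZ_natCast,
        pow_add, sub_right_comm _ (n : ℤ) 1, sub_right_comm _ (n : ℤ) 1]
      ring
    · intro n hn
      rw [Finset.mem_range] at hn ⊢
      omega
    · intro n _ hn
      rw [Finset.mem_range] at hn
      rw [if_neg (by omega), mul_zero]
end
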